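/- For x > 0, let α(x) be the weight sequence α_0 := √x and α_n := √((n+2)/(n+3)) for n ≥ 1, and let W_{α(x)} be the associated unilateral weighted shift on ℓ²(ℕ, ℂ). If 0 < x ≤ 667/990, then W_{α(x)} is quartically hyponormal. -/

import Mathlib

open scoped ComplexOrder
open ContinuousLinearMap

noncomputable section

variable {E : Type*} [NormedAddCommGroup E] [InnerProductSpace ℂ E] [CompleteSpace E]

/-- `T` is hyponormal: `‖T* x‖ ≤ ‖T x‖` for all `x`. -/
def Hyponormal (T : E →L[ℂ] E) : Prop :=
  ∀ x : E, ‖adjoint T x‖ ≤ ‖T x‖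

/-- `T` is `k`-hyponormal: `∑_{i,j=1}^k ⟨(T*^j T^i − T^i T*^j) x_j, x_i⟩ ≥ 0`. -/
def KHyponormal (k : ℕ) (T : E →L[ℂ] E) : Prop :=
  ∀ x : Fin k → E,
    (0 : ℂ) ≤ ∑ i, ∑ j,
      (inner ℂ (x i) ((adjoint T ^ (j.1 + 1) * T ^ (i.1 + 1)
        - T ^ (i.1 + 1) * adjoint T ^ (j.1 + 1)) (x j)) : ℂ)

/-- `T` is weakly `k`-hyponormal: every `∑_{j=1}^k λ_j T^j` is hyponormal. -/
def WeaklyKHyponormal (k : ℕ) (T : E →L[ℂ] E) : Prop :=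
  ∀ lam : Fin k → ℂ, Hyponormal (∑ j : Fin k, lam j • T ^ (j.1 + 1))

/-- The Hilbert space `ℓ²(ℕ, ℂ)`. -/
abbrev H : Type := lp (fun _ : ℕ => ℂ) 2

/-- The canonical orthonormal basis vectors of `ℓ²(ℕ, ℂ)`. -/
def e (n : ℕ) : H := lp.single 2 n 1

/-- `W` is the unilateral weighted shift with weight sequence `α`. -/
def IsWeightedShift (α : ℕ → ℝ) (W : H →L[ℂ] H) : Prop :=
  ∀ n : ℕ, W (e n) = (α n : ℂ) • e (n + 1)

/-- The weight sequence of Theorem 4: `α₀ = √x`, `α_n = √((n+2)/(n+3))` for `n ≥ 1`. -/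
def alphaX (x : ℝ) : ℕ → ℝ := fun n =>
  if n = 0 then Real.sqrt x else Real.sqrt (((n : ℝ) + 2) / ((n : ℝ) + 3))

theorem cauchy_form_ge {ι : Type*} [DecidableEq ι] (p : ι → ℝ) (a : ι) (s : Finset ι)
    (has : a ∉ s) (ha : 0 < p a) (hp : ∀ i ∈ s, 0 < p i) (t : ι → ℝ) :
    t a ^ 2 / (2 * p a) * ∏ k ∈ s, ((p a - p k) / (p a + p k)) ^ 2 ≤
      ∑ i ∈ insert a s, ∑ j ∈ insert a s, t i * t j / (p i + p j) := by
  induction s using Finset.induction_on generalizing t with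
  | empty => simp; apply le_of_eq; ring
  | insert b s hb ih =>
    have hpb : 0 < p b := hp b (by simp)
    have hps : ∀ i ∈ s, 0 < p i := fun i hi => hp i (by simp [hi])
    have hab : b ∉ insert a s := by
      simp only [Finset.mem_insert, not_or] at has ⊢
      exact ⟨fun h => has.1 h.symm, hb⟩
    have has' : a ∉ s := fun h => has (by simp [h])
    have hpi : ∀ i ∈ insert a s, 0 < p i := by
      intro i hi
      rcases Finset.mem_insert.1 hi with rfl | h
      exacts [ha, hps i h]
    specialize ih has' hps (fun i => t i * ((p i - p b) / (p i + p b)))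
    rw [Finset.insert_comm, Finset.prod_insert hb]
    have key : ∑ i ∈ insert b (insert a s), ∑ j ∈ insert b (insert a s), t i * t j / (p i + p j) =
        2 * p b * (∑ i ∈ insert b (insert a s), t i / (p i + p b)) ^ 2 +
        ∑ i ∈ insert a s, ∑ j ∈ insert a s,
          (t i * ((p i - p b) / (p i + p b))) * (t j * ((p j - p b) / (p j + p b)))
            / (p i + p j) := by
      have h1 : ∑ i ∈ insert a s, ∑ j ∈ insert a s,
          (t i * ((p i - p b) / (p i + p b))) * (t j * ((p j - p b) / (p j + p b)))
            / (p i + p j) = ∑ i ∈ insert b (insert a s), ∑ j ∈ insert b (insert a s),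
          (t i * ((p i - p b) / (p i + p b))) * (t j * ((p j - p b) / (p j + p b)))
            / (p i + p j) := by
        simp [Finset.sum_insert hab]
      rw [h1, sq, Finset.sum_mul_sum, Finset.mul_sum, ← Finset.sum_add_distrib]
      refine Finset.sum_congr rfl fun i hi => ?_
      rw [Finset.mul_sum, ← Finset.sum_add_distrib]
      refine Finset.sum_congr rfl fun j hj => ?_
      have hi' : 0 < p i := by
        rcases Finset.mem_insert.1 hi with rfl | h
        exacts [hpb, hpi i h]
      have hj' : 0 < p j := by
        rcases Finset.mem_insert.1 hj with rfl | h
        exacts [hpb, hpi j h]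
      field_simp
      ring
    rw [key]
    have h0 : 0 ≤ 2 * p b * (∑ i ∈ insert b (insert a s), t i / (p i + p b)) ^ 2 := by positivity
    refine le_trans (le_of_eq ?_) (ih.trans (le_add_of_nonneg_left h0))
    ring

theorem cauchy_form_nonneg {ι : Type*} [DecidableEq ι] (p : ι → ℝ) (s : Finset ι)
    (hp : ∀ i ∈ s, 0 < p i) (t : ι → ℝ) :
    0 ≤ ∑ i ∈ s, ∑ j ∈ s, t i * t j / (p i + p j) := by
  rcases s.eq_empty_or_nonempty with rfl | ⟨a, ha⟩
  · simp
  · have h := cauchy_form_ge p a (s.erase a) (by simp) (hp a ha)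
      (fun i hi => hp i (Finset.mem_of_mem_erase hi)) t
    rw [Finset.insert_erase ha] at h
    have := hp a ha
    exact le_trans (by positivity) h

/-- The moments `γ_m` of `W_{α(x)}`, extended by `1` to negative indices. -/
def moment (x : ℝ) (m : ℤ) : ℝ := if m ≤ 0 then 1 else 3 * x / (m + 2)

theorem moment_of_pos (x : ℝ) {m : ℤ} (hm : 0 < m) : moment x m = 3 * x / (m + 2) :=
  if_neg (not_le.2 hm)

theorem moment_zero (x : ℝ) : moment x 0 = 1 := if_pos le_rfl

theorem moment_pos {x : ℝ} (hx : 0 < x) (m : ℤ) : 0 < moment x m := by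
  unfold moment
  split_ifs with h
  · exact one_pos
  · have : (0 : ℝ) < m := by exact_mod_cast not_le.1 h
    positivity

/-- The real quadratic form at level `n` in the decomposition of `‖T f‖² - ‖T* f‖²`. -/
def levelForm (x : ℝ) (n : ℤ) (t : Fin 4 → ℝ) : ℝ :=
  ∑ i : Fin 4, ∑ j : Fin 4, moment x (n + (i.1 + 1) + (j.1 + 1)) * (t i * t j) -
    if 0 ≤ n then (∑ j : Fin 4, moment x (n + (j.1 + 1)) * t j) ^ 2 / moment x n else 0

theorem levelForm_of_pos {x : ℝ} (hx : 0 < x) {n : ℤ} (hn : 0 < n) (t : Fin 4 → ℝ) :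
    levelForm x n t = 3 * x * ∑ i : Fin 4, ∑ j : Fin 4,
      ((i.1 + 1 : ℝ) / (n + i.1 + 3) * t i) * ((j.1 + 1 : ℝ) / (n + j.1 + 3) * t j) /
        (((n + 2 : ℝ) / 2 + (i.1 + 1)) + ((n + 2 : ℝ) / 2 + (j.1 + 1))) := by
  have hn' : (0 : ℝ) < n := by exact_mod_cast hn
  rw [levelForm, if_pos hn.le, moment_of_pos x hn, sq, Finset.sum_mul_sum, Finset.sum_div,
    ← Finset.sum_sub_distrib, Finset.mul_sum]
  refine Finset.sum_congr rfl fun i _ => ?_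
  rw [Finset.sum_div, ← Finset.sum_sub_distrib, Finset.mul_sum]
  refine Finset.sum_congr rfl fun j _ => ?_
  rw [moment_of_pos x (by lia), moment_of_pos x (by lia), moment_of_pos x (by lia)]
  push_cast
  have hi : (0 : ℝ) ≤ i.1 := by positivity
  have hj : (0 : ℝ) ≤ j.1 := by positivity
  generalize (i.1 : ℝ) = a at *
  generalize (j.1 : ℝ) = b at *
  have h1 : (n : ℝ) + (a + 1) + 2 ≠ 0 := by positivity
  have h2 : (n : ℝ) + (b + 1) + 2 ≠ 0 := by positivity
  have h3 : (n : ℝ) + (a + 1) + (b + 1) + 2 ≠ 0 := by positivity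
  have h4 : (n : ℝ) + a + 3 ≠ 0 := by positivity
  have h5 : (n : ℝ) + b + 3 ≠ 0 := by positivity
  have h6 : (n + 2 : ℝ) / 2 + (a + 1) + ((n + 2 : ℝ) / 2 + (b + 1)) ≠ 0 := by positivity
  rw [show (n : ℝ) + (a + 1) + 2 = n + a + 3 by ring,
    show (n : ℝ) + (b + 1) + 2 = n + b + 3 by ring,
    show (n + 2 : ℝ) / 2 + (a + 1) + ((n + 2 : ℝ) / 2 + (b + 1)) =
      (n : ℝ) + (a + 1) + (b + 1) + 2 by ring]
  field_simp
  ring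

theorem levelForm_of_neg (x : ℝ) {n : ℤ} (hn : n < 0) (t : Fin 4 → ℝ)
    (ht : ∀ i : Fin 4, n + (i.1 + 1) < 0 → t i = 0) :
    levelForm x n t = 3 * x * ∑ i : Fin 4 with 0 ≤ n + ((i.1 : ℤ) + 1),
      ∑ j : Fin 4 with 0 ≤ n + ((j.1 : ℤ) + 1),
        t i * t j / (((n + 2 : ℝ) / 2 + (i.1 + 1)) + ((n + 2 : ℝ) / 2 + (j.1 + 1))) := by
  rw [levelForm, if_neg (not_le.2 hn), sub_zero, Finset.mul_sum, Finset.sum_filter]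
  refine Finset.sum_congr rfl fun i _ => ?_
  split_ifs with hi
  · rw [Finset.mul_sum, Finset.sum_filter]
    refine Finset.sum_congr rfl fun j _ => ?_
    split_ifs with hj
    · rw [moment_of_pos x (by lia)]
      push_cast
      ring
    · rw [ht j (not_le.1 hj)]
      ring
  · simp [ht i (not_le.1 hi)]

theorem levelForm_nonneg {x : ℝ} (hx : 0 < x) {n : ℤ} (hn : n ≠ 0) (t : Fin 4 → ℝ)
    (ht : ∀ i : Fin 4, n + (i.1 + 1) < 0 → t i = 0) : 0 ≤ levelForm x n t := by
  rcases hn.lt_or_gt with hn | hn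
  · rw [levelForm_of_neg x hn t ht]
    refine mul_nonneg (by positivity) (cauchy_form_nonneg
      (fun i : Fin 4 => (n + 2 : ℝ) / 2 + (i.1 + 1)) _ (fun i hi => ?_) t)
    have h1 : (0 : ℝ) ≤ n + (i.1 + 1) := by exact_mod_cast (Finset.mem_filter.1 hi).2
    have h2 : (0 : ℝ) ≤ i.1 := by positivity
    linarith
  · rw [levelForm_of_pos hx hn t]
    have hn' : (0 : ℝ) < n := by exact_mod_cast hn
    exact mul_nonneg (by positivity) (cauchy_form_nonneg
      (fun i : Fin 4 => (n + 2 : ℝ) / 2 + (i.1 + 1)) _ (fun i _ => by positivity)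
      (fun i => (i.1 + 1 : ℝ) / (n + i.1 + 3) * t i))

theorem levelForm_one_ge {x : ℝ} (hx : 0 < x) (t : Fin 4 → ℝ) :
    3 * x * (t 0 ^ 2 / 250880) ≤ levelForm x 1 t := by
  rw [levelForm_of_pos hx one_pos t]
  refine mul_le_mul_of_nonneg_left ?_ (by positivity)
  have h := cauchy_form_ge (fun i : Fin 4 => (((1 : ℤ) + 2 : ℝ) / 2 + (i.1 + 1))) 0 {1, 2, 3}
    (by decide) (by norm_num) (fun i _ => by positivity)
    (fun i => (i.1 + 1 : ℝ) / ((1 : ℤ) + i.1 + 3) * t i)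
  rw [show (insert 0 {1, 2, 3} : Finset (Fin 4)) = Finset.univ by decide] at h
  refine le_trans (le_of_eq ?_) h
  rw [Finset.prod_insert (by decide), Finset.prod_insert (by decide), Finset.prod_singleton]
  norm_num
  ring

theorem levelForm_neg_one_ge {x : ℝ} (hx : 0 < x) (t : Fin 4 → ℝ) :
    3 * x * (t 1 ^ 2 / 35280) ≤ levelForm x (-1) t := by
  rw [levelForm_of_neg x (by decide) t (fun i hi => by lia),
    show (Finset.univ.filter fun i : Fin 4 => 0 ≤ -1 + ((i.1 : ℤ) + 1)) = Finset.univ by decide]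
  refine mul_le_mul_of_nonneg_left ?_ (by positivity)
  have h := cauchy_form_ge (fun i : Fin 4 => (((-1 : ℤ) + 2 : ℝ) / 2 + (i.1 + 1))) 1 {0, 2, 3}
    (by decide) (by norm_num) (fun i _ => by push_cast; positivity) t
  rw [show (insert 1 {0, 2, 3} : Finset (Fin 4)) = Finset.univ by decide] at h
  refine le_trans (le_of_eq ?_) h
  rw [Finset.prod_insert (by decide), Finset.prod_insert (by decide), Finset.prod_singleton]
  norm_num
  ring

theorem levelForm_zero_ge {x : ℝ} (hx : 0 < x) (hx' : x ≤ 667 / 990) (t : Fin 4 → ℝ) :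
    3 * x * (t 0 * t 1 / 47040) ≤ levelForm x 0 t := by
  obtain ⟨v, rfl⟩ : ∃ v : Fin 4 → ℝ, t = fun i => (i.1 + 3) * v i :=
    ⟨fun i => t i / (i.1 + 3), funext fun i => by field_simp⟩
  have h : levelForm x 0 (fun i => (i.1 + 3) * v i) =
      3 * x * (∑ i : Fin 4, ∑ j : Fin 4, (i.1 + 1 : ℝ) * (j.1 + 1) / (i.1 + j.1 + 4) * (v i * v j)
        - (3 * x - 2) * (v 0 + v 1 + v 2 + v 3) ^ 2) := by
    simp [levelForm, Fin.sum_univ_four, moment]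
    norm_num
    ring
  rw [h]
  refine mul_le_mul_of_nonneg_left ?_ (by positivity)
  have h2 : (3 * x - 2) * (v 0 + v 1 + v 2 + v 3) ^ 2 ≤ 7 / 330 * (v 0 + v 1 + v 2 + v 3) ^ 2 :=
    mul_le_mul_of_nonneg_right (by linarith) (sq_nonneg _)
  simp only [Fin.sum_univ_four]
  norm_num
  linarith [sq_nonneg (v 0 + 97967 / 59192 * v 1 + 316 / 151 * v 2 + 2542 / 1057 * v 3),
    sq_nonneg (v 1 + 484512 / 208769 * v 2 + 18972912 / 5219225 * v 3),
    sq_nonneg (v 2 + 12700 / 4311 * v 3), sq_nonneg (v 3)]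

theorem inner_e (n : ℕ) (f : H) : inner ℂ (e n) f = f n := by
  simp [e, lp.inner_single_left]

/-- The coefficients `a_m` of `f` normalised by `f_m = √γ_m a_m`, extended by `0` to `m < 0`. -/
def coeff (x : ℝ) (f : H) (m : ℤ) : ℂ :=
  if 0 ≤ m then f m.toNat / (√(moment x m) : ℂ) else 0

theorem coeff_of_neg (x : ℝ) (f : H) {m : ℤ} (hm : m < 0) : coeff x f m = 0 :=
  if_neg (not_le.2 hm)

theorem coeff_natCast (x : ℝ) (f : H) (m : ℕ) :
    coeff x f m = f m / (√(moment x m) : ℂ) := by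
  simp [coeff]

theorem coeff_sum_smul {ι : Type*} (x : ℝ) (s : Finset ι) (c : ι → ℂ) (g : ι → H) (m : ℤ) :
    coeff x (∑ i ∈ s, c i • g i) m = ∑ i ∈ s, c i * coeff x (g i) m := by
  unfold coeff
  split_ifs
  · simp only [← inner_e, inner_sum, inner_smul_right, Finset.sum_div, mul_div_assoc]
  · simp

theorem sq_sqrt_moment {x : ℝ} (hx : 0 < x) (m : ℤ) :
    (√(moment x m) : ℂ) * (√(moment x m) : ℂ) = moment x m := by
  exact_mod_cast Real.mul_self_sqrt (moment_pos hx m).le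

theorem sqrt_moment_ne_zero {x : ℝ} (hx : 0 < x) (m : ℤ) : (√(moment x m) : ℂ) ≠ 0 := by
  exact_mod_cast (Real.sqrt_pos.2 (moment_pos hx m)).ne'

theorem hasSum_coeff_inner {x : ℝ} (hx : 0 < x) (f g : H) :
    HasSum (fun m : ℤ => moment x m * (coeff x g m * starRingEnd ℂ (coeff x f m)))
      (inner ℂ f g) := by
  rw [← Function.Injective.hasSum_iff (Nat.cast_injective (R := ℤ))]
  · refine Eq.subst (motive := fun F => HasSum F (inner ℂ f g)) (funext fun m => ?_)
      (lp.hasSum_inner (𝕜 := ℂ) f g)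
    have h := sqrt_moment_ne_zero hx m
    simp only [Function.comp_apply, coeff_natCast, map_div₀, Complex.conj_ofReal,
      RCLike.inner_apply, ← sq_sqrt_moment hx]
    field_simp
  · intro m hm
    have : m < 0 := by
      by_contra h
      exact hm ⟨m.toNat, Int.toNat_of_nonneg (not_lt.1 h)⟩
    simp [coeff_of_neg x _ this]

theorem alphaX_mul_sqrt_moment {x : ℝ} (hx : 0 < x) (n : ℕ) :
    alphaX x n * √(moment x n) = √(moment x (n + 1 : ℕ)) := by
  rcases n.eq_zero_or_pos with rfl | hn
  · rw [moment_of_pos x (m := (0 + 1 : ℕ)) (by simp)]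
    norm_num [alphaX, moment_zero]
  · have hn' : (0 : ℝ) < n := by exact_mod_cast hn
    rw [alphaX, if_neg hn.ne', ← Real.sqrt_mul (by positivity), moment_of_pos x (by lia),
      moment_of_pos x (by lia)]
    congr 1
    push_cast
    field_simp
    ring

section WeightedShift

variable {α : ℕ → ℝ} {W : H →L[ℂ] H}

theorem IsWeightedShift.adjoint_apply (hW : IsWeightedShift α W) (f : H) (n : ℕ) :
    adjoint W f n = α n * f (n + 1) := by
  rw [← inner_e, adjoint_inner_right, hW n, inner_smul_left, inner_e, Complex.conj_ofReal]

theorem IsWeightedShift.apply_zero (hW : IsWeightedShift α W) (f : H) : W f 0 = 0 := by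
  have h : adjoint W (e 0) = 0 := by
    ext n
    rw [hW.adjoint_apply]
    simp [e]
  rw [← inner_e, ← adjoint_inner_left, h, inner_zero_left]

theorem IsWeightedShift.apply_succ (hW : IsWeightedShift α W) (f : H) (n : ℕ) :
    W f (n + 1) = α n * f n := by
  have h : adjoint W (e (n + 1)) = (α n : ℂ) • e n := by
    ext m
    rw [hW.adjoint_apply]
    rcases eq_or_ne m n with rfl | hm
    · simp [e, lp.coeFn_smul, -Complex.coe_smul]
    · simp [e, hm, lp.coeFn_smul, -Complex.coe_smul]
  rw [← inner_e, ← adjoint_inner_left, h, inner_smul_left, inner_e, Complex.conj_ofReal]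

end WeightedShift

section Coefficients

variable {x : ℝ} {W : H →L[ℂ] H}

theorem coeff_shift (hx : 0 < x) (hW : IsWeightedShift (alphaX x) W) (f : H) (m : ℤ) :
    coeff x (W f) m = coeff x f (m - 1) := by
  rcases lt_trichotomy m 0 with hm | rfl | hm
  · rw [coeff_of_neg x _ hm, coeff_of_neg x _ (by lia)]
  · rw [coeff_of_neg x f (by lia), ← Nat.cast_zero, coeff_natCast, hW.apply_zero, zero_div]
  · obtain ⟨n, rfl⟩ : ∃ n : ℕ, m = (n + 1 : ℕ) := ⟨(m - 1).toNat, by lia⟩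
    rw [show ((n + 1 : ℕ) : ℤ) - 1 = n by simp, coeff_natCast, coeff_natCast, hW.apply_succ,
      ← alphaX_mul_sqrt_moment hx]
    have h1 := sqrt_moment_ne_zero hx n
    have h2 := sqrt_moment_ne_zero hx (n + 1 : ℕ)
    rw [← alphaX_mul_sqrt_moment hx] at h2
    push_cast at h2 ⊢
    have h3 := left_ne_zero_of_mul h2
    field_simp

theorem coeff_shift_pow (hx : 0 < x) (hW : IsWeightedShift (alphaX x) W) (f : H) (k : ℕ)
    (m : ℤ) : coeff x ((W ^ k) f) m = coeff x f (m - k) := by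
  induction k generalizing m with
  | zero => simp
  | succ k ih =>
    rw [pow_succ', mul_apply_eq_comp, coeff_shift hx hW, ih]
    congr 1
    push_cast
    ring

theorem moment_mul_coeff_adjoint (hx : 0 < x) (hW : IsWeightedShift (alphaX x) W) (f : H) {m : ℤ}
    (hm : 0 ≤ m) :
    moment x m * coeff x (adjoint W f) m = moment x (m + 1) * coeff x f (m + 1) := by
  lift m to ℕ using hm
  rw [← Nat.cast_succ, coeff_natCast, coeff_natCast, hW.adjoint_apply, ← sq_sqrt_moment hx,
    ← sq_sqrt_moment hx]
  have h1 := sqrt_moment_ne_zero hx m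
  have h2 := sqrt_moment_ne_zero hx (m + 1 : ℕ)
  have h3 : (alphaX x m : ℂ) * √(moment x m) = √(moment x (m + 1 : ℕ)) := by
    exact_mod_cast alphaX_mul_sqrt_moment hx m
  field_simp
  rw [← h3]
  ring

theorem moment_mul_coeff_adjoint_pow (hx : 0 < x) (hW : IsWeightedShift (alphaX x) W) (f : H)
    (k : ℕ) {m : ℤ} (hm : 0 ≤ m) :
    moment x m * coeff x ((adjoint W ^ k) f) m = moment x (m + k) * coeff x f (m + k) := by
  induction k generalizing m with
  | zero => simp
  | succ k ih =>
    rw [pow_succ', mul_apply_eq_comp, moment_mul_coeff_adjoint hx hW _ hm, ih (by lia)]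
    congr 2 <;> push_cast <;> ring_nf

end Coefficients

/-- The coordinates `λ̄_i a_{n+i}` on which the level-`n` forms act. -/
def levelVec (x : ℝ) (lam : Fin 4 → ℂ) (f : H) (n : ℤ) (i : Fin 4) : ℂ :=
  starRingEnd ℂ (lam i) * coeff x f (n + (i.1 + 1))

section Decomposition

variable {x : ℝ} {W : H →L[ℂ] H}

theorem hasSum_norm_sq_apply (hx : 0 < x) (hW : IsWeightedShift (alphaX x) W)
    (lam : Fin 4 → ℂ) (f : H) :
    HasSum (fun n : ℤ => ∑ i : Fin 4, ∑ j : Fin 4, (moment x (n + (i.1 + 1) + (j.1 + 1)) : ℂ) *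
        (levelVec x lam f n i * starRingEnd ℂ (levelVec x lam f n j)))
      (inner ℂ ((∑ j : Fin 4, lam j • W ^ (j.1 + 1)) f)
        ((∑ j : Fin 4, lam j • W ^ (j.1 + 1)) f)) := by
  simp only [sum_apply, smul_apply, sum_inner]
  simp only [inner_sum, inner_smul_left, inner_smul_right]
  refine hasSum_sum fun i _ => hasSum_sum fun j _ => ?_
  have h := hasSum_coeff_inner hx ((W ^ (i.1 + 1)) f) ((W ^ (j.1 + 1)) f)
  simp only [coeff_shift_pow hx hW] at h
  rw [← (Equiv.addRight (((i.1 : ℤ) + 1) + (j.1 + 1))).hasSum_iff] at h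
  refine Eq.subst (motive := fun F => HasSum F _) (funext fun n => ?_)
    ((h.mul_left (starRingEnd ℂ (lam i))).mul_left (lam j))
  simp only [Function.comp_apply, Equiv.coe_addRight, levelVec, map_mul, Complex.conj_conj]
  rw [show n + ((i.1 : ℤ) + 1 + (j.1 + 1)) - ((j.1 + 1 : ℕ) : ℤ) = n + (i.1 + 1) by
    push_cast; ring, show n + ((i.1 : ℤ) + 1 + (j.1 + 1)) - ((i.1 + 1 : ℕ) : ℤ) = n + (j.1 + 1) by
    push_cast; ring, show n + ((i.1 : ℤ) + 1 + (j.1 + 1)) = n + (i.1 + 1) + (j.1 + 1) by ring]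
  ring

theorem hasSum_norm_sq_adjoint_apply (hx : 0 < x) (hW : IsWeightedShift (alphaX x) W)
    (lam : Fin 4 → ℂ) (f : H) :
    HasSum (fun n : ℤ => if 0 ≤ n then
        ((Complex.normSq (∑ j : Fin 4, (moment x (n + (j.1 + 1)) : ℂ) * levelVec x lam f n j)
          / moment x n : ℝ) : ℂ) else 0)
      (inner ℂ (adjoint (∑ j : Fin 4, lam j • W ^ (j.1 + 1)) f)
        (adjoint (∑ j : Fin 4, lam j • W ^ (j.1 + 1)) f)) := by
  convert hasSum_coeff_inner hx _ _ using 1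
  ext n
  split_ifs with hn
  · have h0 : (moment x n : ℂ) ≠ 0 := by exact_mod_cast (moment_pos hx n).ne'
    have h : ∑ j : Fin 4, (moment x (n + (j.1 + 1)) : ℂ) * levelVec x lam f n j =
        moment x n * coeff x (adjoint (∑ j : Fin 4, lam j • W ^ (j.1 + 1)) f) n := by
      have h1 : adjoint (∑ j : Fin 4, lam j • W ^ (j.1 + 1)) f =
          ∑ j : Fin 4, starRingEnd ℂ (lam j) • (adjoint W ^ (j.1 + 1)) f := by
        simp only [← star_eq_adjoint, star_sum, star_smul, star_pow, sum_apply, smul_apply]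
        rfl
      rw [h1, coeff_sum_smul, Finset.mul_sum]
      refine Finset.sum_congr rfl fun j _ => ?_
      rw [mul_left_comm, moment_mul_coeff_adjoint_pow hx hW f _ hn, levelVec]
      push_cast
      ring
    rw [h, Complex.ofReal_div, ← Complex.mul_conj, map_mul, Complex.conj_ofReal]
    field_simp
  · simp [coeff_of_neg x _ (not_le.1 hn)]

theorem hasSum_levelForm (hx : 0 < x) (hW : IsWeightedShift (alphaX x) W)
    (lam : Fin 4 → ℂ) (f : H) :
    HasSum (fun n : ℤ => levelForm x n (fun i => (levelVec x lam f n i).re) +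
        levelForm x n (fun i => (levelVec x lam f n i).im))
      (‖(∑ j : Fin 4, lam j • W ^ (j.1 + 1)) f‖ ^ 2 -
        ‖adjoint (∑ j : Fin 4, lam j • W ^ (j.1 + 1)) f‖ ^ 2) := by
  have h := Complex.hasSum_re
    ((hasSum_norm_sq_apply hx hW lam f).sub (hasSum_norm_sq_adjoint_apply hx hW lam f))
  rw [Complex.sub_re] at h
  convert h using 1
  · ext n
    rw [Complex.sub_re, Complex.re_sum]
    simp only [Complex.re_sum, levelForm]
    rw [show ∀ a b c d : ℝ, a - b + (c - d) = a + c - (b + d) by intros; ring]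
    congr 1
    · simp only [← Finset.sum_add_distrib]
      refine Finset.sum_congr rfl fun i _ => Finset.sum_congr rfl fun j _ => ?_
      rw [Complex.re_ofReal_mul, Complex.mul_re, Complex.conj_re, Complex.conj_im]
      ring
    · split_ifs
      · rw [Complex.ofReal_re, Complex.normSq_apply, Complex.re_sum, Complex.im_sum]
        simp only [Complex.re_ofReal_mul, Complex.im_ofReal_mul]
        ring
      · simp
  · rw [← inner_self_eq_norm_sq (𝕜 := ℂ), ← inner_self_eq_norm_sq (𝕜 := ℂ)]
    rfl

theorem levelForm_sum_nonneg (hx : 0 < x) (hx' : x ≤ 667 / 990) (lam : Fin 4 → ℂ) (f : H) :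
    0 ≤ ∑ n ∈ ({-1, 0, 1} : Finset ℤ), (levelForm x n (fun i => (levelVec x lam f n i).re) +
        levelForm x n (fun i => (levelVec x lam f n i).im)) := by
  rw [Finset.sum_insert (by decide), Finset.sum_insert (by decide), Finset.sum_singleton]
  set u := levelVec x lam f 1 0 with hu
  set v := levelVec x lam f (-1) 1 with hv
  set p := levelVec x lam f 0 0 with hp
  set q := levelVec x lam f 0 1 with hq
  have hnorm : ‖u‖ * ‖v‖ = ‖p‖ * ‖q‖ := by
    simp [hu, hv, hp, hq, levelVec]
    ring
  have h1 := levelForm_one_ge hx fun i => (levelVec x lam f 1 i).re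
  have h2 := levelForm_one_ge hx fun i => (levelVec x lam f 1 i).im
  have h3 := levelForm_neg_one_ge hx fun i => (levelVec x lam f (-1) i).re
  have h4 := levelForm_neg_one_ge hx fun i => (levelVec x lam f (-1) i).im
  have h5 := levelForm_zero_ge hx hx' fun i => (levelVec x lam f 0 i).re
  have h6 := levelForm_zero_ge hx hx' fun i => (levelVec x lam f 0 i).im
  rw [← hu] at h1 h2
  rw [← hv] at h3 h4
  rw [← hp, ← hq] at h5 h6
  have hre : -(‖p‖ * ‖q‖) ≤ p.re * q.re + p.im * q.im := by
    have h := (abs_le.1 (Complex.abs_re_le_norm (p * starRingEnd ℂ q))).1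
    rw [norm_mul, RCLike.norm_conj, Complex.mul_re, Complex.conj_re, Complex.conj_im] at h
    linarith
  have hu2 : ‖u‖ ^ 2 = u.re ^ 2 + u.im ^ 2 := by
    rw [Complex.sq_norm, Complex.normSq_apply]; ring
  have hv2 : ‖v‖ ^ 2 = v.re ^ 2 + v.im ^ 2 := by
    rw [Complex.sq_norm, Complex.normSq_apply]; ring
  have key : 0 ≤ 3 * x * ((u.re ^ 2 + u.im ^ 2) / 250880 + (v.re ^ 2 + v.im ^ 2) / 35280 +
      (p.re * q.re + p.im * q.im) / 47040) := by
    refine mul_nonneg (by positivity) ?_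
    rw [← hu2, ← hv2]
    linarith [sq_nonneg (3 * ‖u‖ - 8 * ‖v‖)]
  linarith

end Decomposition

/-- If `0 < x ≤ 667/990` then `W_{α(x)}` is quartically hyponormal. -/
theorem quartically_hyponormal_of_le (x : ℝ) (hx : 0 < x) (hx' : x ≤ 667 / 990)
    (W : H →L[ℂ] H) (hW : IsWeightedShift (alphaX x) W) :
    WeaklyKHyponormal 4 W := by
  intro lam f
  have h := sum_le_hasSum ({-1, 0, 1} : Finset ℤ) (fun n hn => ?_) (hasSum_levelForm hx hW lam f)
  · have h' := (levelForm_sum_nonneg hx hx' lam f).trans h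
    exact (sq_le_sq₀ (norm_nonneg _) (norm_nonneg _)).1 (by linarith)
  · have hn0 : n ≠ 0 := by
      rintro rfl
      simp at hn
    have hv : ∀ i : Fin 4, n + (i.1 + 1) < 0 → levelVec x lam f n i = 0 := fun i hi => by
      simp [levelVec, coeff_of_neg x f hi]
    exact add_nonneg (levelForm_nonneg hx hn0 _ fun i hi => by simp [hv i hi])
      (levelForm_nonneg hx hn0 _ fun i hi => by simp [hv i hi])
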